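/- arXiv:math/0403093 — 2 statements merged into one kernel-verified Lean document; each statement's English description precedes it below -/
import Mathlib

section
/- Let X be a direct limit sequence of topological spaces (X_n, t_n). If each (X_n, t_n) is a locally compact Hausdorff space, then X is Hausdorff. -/
open Set Topology

/-- In a locally compact Hausdorff space, disjoint compact sets have disjoint compact
neighbourhoods. -/
theorem exists_disjoint_compact_nhdsSet {Y : Type*} [TopologicalSpace Y] [LocallyCompactSpace Y]
    [T2Space Y] {K L : Set Y} (hK : IsCompact K) (hL : IsCompact L) (h : Disjoint K L) :
    ∃ K' L' : Set Y, IsCompact K' ∧ IsCompact L' ∧ Disjoint K' L' ∧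
      (∀ z ∈ K, K' ∈ 𝓝 z) ∧ ∀ z ∈ L, L' ∈ 𝓝 z := by
  obtain ⟨U, V, hU, hV, hKU, hLV, hUV⟩ := SeparatedNhds.of_isCompact_isCompact hK hL h
  obtain ⟨K', hK', hKK', hK'U⟩ := exists_compact_between hK hU hKU
  obtain ⟨L', hL', hLL', hL'V⟩ := exists_compact_between hL hV hLV
  exact ⟨K', L', hK', hL', hUV.mono hK'U hL'V,
    fun z hz => mem_interior_iff_mem_nhds.1 (hKK' hz),
    fun z hz => mem_interior_iff_mem_nhds.1 (hLL' hz)⟩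

/-- In a direct limit sequence, the union of a sequence of sets `K k ⊆ A (n + k)` is open if each
`K (k + 1)` is a neighbourhood of `K k` in `A (n + k + 1)`. -/
theorem isOpen_iUnion_of_directLimitSequence {X : Type*} [TopologicalSpace X]
    {A : ℕ → Set X} (t : ∀ n, TopologicalSpace (A n)) (hmono : Monotone A)
    (hincl : ∀ m n (h : m ≤ n),
      @Continuous _ _ (t m) (t n) (Set.inclusion (hmono h)))
    (hfinal : ∀ U : Set X, IsOpen U ↔
      ∀ n, @IsOpen _ (t n) ((Subtype.val : A n → X) ⁻¹' U))
    {n : ℕ} {K : ℕ → Set X} (hKA : ∀ k, K k ⊆ A (n + k))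
    (hK : ∀ k (z : A (n + (k + 1))), (z : X) ∈ K k →
      Subtype.val ⁻¹' K (k + 1) ∈ @nhds _ (t (n + (k + 1))) z) :
    IsOpen (⋃ k, K k) := by
  have hKmono : Monotone K := monotone_nat_of_le_succ fun k z hz =>
    have h := mem_of_mem_nhds (hK k ⟨z, hmono (by lia) (hKA k hz)⟩ hz)
    h
  refine (hfinal _).2 fun m => isOpen_iff_mem_nhds.2 fun z hz => ?_
  obtain ⟨k, hk⟩ := mem_iUnion.1 hz
  have hm : m ≤ n + (k + m + 1) := by lia
  have hnhds := hK (k + m) (inclusion (hmono hm) z) (hKmono (Nat.le_add_right k m) hk)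
  exact Filter.mem_of_superset ((hincl m _ hm).continuousAt.preimage_mem_nhds hnhds)
    fun w hw => mem_iUnion.2 ⟨_, hw⟩


/-- Lemma 1.7(c): a direct limit sequence of locally compact Hausdorff spaces is Hausdorff. -/
theorem t2_of_directLimitSequence {X : Type*} [TopologicalSpace X]
    (A : ℕ → Set X) (t : ∀ n, TopologicalSpace (A n))
    (hmono : Monotone A)
    (hunion : ⋃ n, A n = Set.univ)
    (hincl : ∀ m n (h : m ≤ n),
      @Continuous _ _ (t m) (t n) (Set.inclusion (hmono h)))
    (hfinal : ∀ U : Set X, IsOpen U ↔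
      ∀ n, @IsOpen _ (t n) ((Subtype.val : A n → X) ⁻¹' U))
    (hlc : ∀ n, @LocallyCompactSpace _ (t n))
    (hT2 : ∀ n, @T2Space _ (t n)) :
    T2Space X := by
  let P (n : ℕ) (K L : Set X) : Prop := K ⊆ A n ∧ L ⊆ A n ∧ Disjoint K L ∧
    IsCompact ((↑) ⁻¹' K : Set (A n)) ∧ IsCompact ((↑) ⁻¹' L : Set (A n))
  have step (n : ℕ) (p : {p : Set X × Set X // P n p.1 p.2}) :
      ∃ q : {q : Set X × Set X // P (n + 1) q.1 q.2}, ∀ z : A (n + 1),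
        ((z : X) ∈ p.1.1 → (↑) ⁻¹' q.1.1 ∈ 𝓝 z) ∧ ((z : X) ∈ p.1.2 → (↑) ⁻¹' q.1.2 ∈ 𝓝 z) := by
    obtain ⟨⟨K, L⟩, hKA, hLA, hKL, hK, hL⟩ := p
    have hi := hincl n (n + 1) n.le_succ
    have himage {S : Set X} (hS : S ⊆ A n) :
        inclusion (hmono n.le_succ) '' ((↑) ⁻¹' S) = ((↑) ⁻¹' S : Set (A (n + 1))) := by
      ext z
      exact ⟨by rintro ⟨w, hw, rfl⟩; exact hw, fun hz => ⟨⟨z, hS hz⟩, hz, rfl⟩⟩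
    have hK₁ := hK.image hi
    have hL₁ := hL.image hi
    rw [himage hKA] at hK₁
    rw [himage hLA] at hL₁
    obtain ⟨K', L', hK', hL', hd, hKK', hLL'⟩ :=
      exists_disjoint_compact_nhdsSet hK₁ hL₁ (hKL.preimage _)
    refine ⟨⟨((↑) '' K', (↑) '' L'), Subtype.coe_image_subset _ _, Subtype.coe_image_subset _ _,
      (disjoint_image_iff Subtype.val_injective).2 hd, ?_, ?_⟩, fun z => ⟨fun hz => ?_, fun hz => ?_⟩⟩
    all_goals simp only [preimage_image_eq _ Subtype.val_injective]
    exacts [hK', hL', hKK' z hz, hLL' z hz]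
  choose next hnext using step
  refine ⟨fun x y hxy => ?_⟩
  obtain ⟨a, ha⟩ := mem_iUnion.1 (hunion ▸ mem_univ x)
  obtain ⟨b, hb⟩ := mem_iUnion.1 (hunion ▸ mem_univ y)
  obtain ⟨n, hx, hy⟩ : ∃ n, x ∈ A n ∧ y ∈ A n :=
    ⟨max a b, hmono (le_max_left a b) ha, hmono (le_max_right a b) hb⟩
  have hfin (w : X) : IsCompact ((↑) ⁻¹' {w} : Set (A n)) :=
    ((finite_singleton w).preimage Subtype.val_injective.injOn).isCompact
  let s (k : ℕ) : {p : Set X × Set X // P (n + k) p.1 p.2} :=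
    Nat.rec ⟨({x}, {y}), singleton_subset_iff.2 hx, singleton_subset_iff.2 hy,
      disjoint_singleton.2 hxy, hfin x, hfin y⟩ (fun k p => next (n + k) p) k
  have hs (k : ℕ) := hnext (n + k) (s k)
  have hs₁ : Monotone fun k => (s k).1.1 := monotone_nat_of_le_succ fun k z hz =>
    have h := mem_of_mem_nhds ((hs k ⟨z, hmono (Nat.le_succ _) ((s k).2.1 hz)⟩).1 hz)
    h
  have hs₂ : Monotone fun k => (s k).1.2 := monotone_nat_of_le_succ fun k z hz =>
    have h := mem_of_mem_nhds ((hs k ⟨z, hmono (Nat.le_succ _) ((s k).2.2.1 hz)⟩).2 hz)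
    h
  refine ⟨⋃ k, (s k).1.1, ⋃ k, (s k).1.2,
    isOpen_iUnion_of_directLimitSequence t hmono hincl hfinal (fun k => (s k).2.1)
      fun k z => (hs k z).1,
    isOpen_iUnion_of_directLimitSequence t hmono hincl hfinal (fun k => (s k).2.2.1)
      fun k z => (hs k z).2,
    mem_iUnion.2 ⟨0, mem_singleton x⟩, mem_iUnion.2 ⟨0, mem_singleton y⟩, ?_⟩
  simp only [disjoint_iUnion_left, disjoint_iUnion_right]
  exact fun j i => (s (max i j)).2.2.2.1.mono (hs₁ (le_max_left _ _)) (hs₂ (le_max_right _ _))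
end

section
/- Let X be a direct limit sequence of topological spaces (X_n, t_n), where each (X_n, t_n) is a T1 space and each inclusion map (X_n, t_n) → X is a topological embedding. Fix k ∈ ℕ and x ∈ X_k. Then: (i) every continuous loop γ : [0,1] → X based at x has image contained in some X_n with n ≥ k, and the corestriction γ : [0,1] → (X_n, t_n) is continuous; (ii) if two continuous loops based at x with values in (X_n, t_n) are homotopic relative to endpoints in X, then there exists m ≥ n such that they are homotopic relative to endpoints in (X_m, t_m). -/
open unitInterval

/-- In the direct limit of an increasing sequence of T1 spaces, every compact set is contained in
one of the steps. -/
theorem IsCompact.exists_subset_of_directLimitSequence {X : Type*} [TopologicalSpace X]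
    {A : ℕ → Set X} (t : ∀ n, TopologicalSpace (A n)) (hmono : Monotone A)
    (hunion : ⋃ n, A n = Set.univ)
    (hfinal : ∀ U : Set X, IsOpen U ↔
      ∀ n, @IsOpen _ (t n) ((Subtype.val : A n → X) ⁻¹' U))
    (hT1 : ∀ n, @T1Space _ (t n)) {K : Set X} (hK : IsCompact K) : ∃ n, K ⊆ A n := by
  by_contra! h
  choose y hyK hyA using fun n => Set.not_subset.1 (h n)
  have hlt {m j : ℕ} (hj : y j ∈ A m) : j < m :=
    lt_of_not_ge fun hmj => hyA j (hmono hmj hj)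
  have hopen (n : ℕ) : IsOpen (y '' Set.Ici n)ᶜ := by
    refine (hfinal _).2 fun m => ?_
    have := hT1 m
    rw [Set.preimage_compl]
    refine (Set.Finite.isClosed ?_).isOpen_compl
    refine (((Set.finite_Iio m).image y).preimage Subtype.val_injective.injOn).subset ?_
    rintro ⟨_, hz⟩ ⟨j, -, rfl⟩
    exact ⟨j, hlt hz, rfl⟩
  have hcover : K ⊆ ⋃ n, (y '' Set.Ici n)ᶜ := fun z _ => by
    obtain ⟨m, hm⟩ := Set.mem_iUnion.1 (hunion ▸ Set.mem_univ z)
    refine Set.mem_iUnion.2 ⟨m, ?_⟩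
    rintro ⟨j, hj, rfl⟩
    exact (hlt hm).not_ge hj
  have hdir : Directed (· ⊆ ·) fun n => (y '' Set.Ici n)ᶜ :=
    Monotone.directed_le fun _ _ hab =>
      Set.compl_subset_compl.2 (Set.image_mono (Set.Ici_subset_Ici.2 hab))
  obtain ⟨n, hn⟩ := hK.elim_directed_cover _ hopen hcover hdir
  exact hn (hyK n) ⟨n, Set.self_mem_Ici, rfl⟩

/-- A continuous map from a compact space to the direct limit of an increasing sequence of
embedded T1 spaces corestricts to a continuous map into arbitrarily late steps. -/
theorem Continuous.exists_corestrict_of_directLimitSequence {X Y : Type*}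
    [topX : TopologicalSpace X] [TopologicalSpace Y] [CompactSpace Y]
    {A : ℕ → Set X} (t : ∀ n, TopologicalSpace (A n)) (hmono : Monotone A)
    (hunion : ⋃ n, A n = Set.univ)
    (hfinal : ∀ U : Set X, IsOpen U ↔
      ∀ n, @IsOpen _ (t n) ((Subtype.val : A n → X) ⁻¹' U))
    (hT1 : ∀ n, @T1Space _ (t n))
    (hemb : ∀ n, t n = TopologicalSpace.induced (Subtype.val : A n → X) topX)
    {f : Y → X} (hf : Continuous f) (k : ℕ) :
    ∃ n, k ≤ n ∧ ∃ hsub : ∀ y, f y ∈ A n,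
      @Continuous _ _ _ (t n) (fun y => (⟨f y, hsub y⟩ : A n)) := by
  obtain ⟨n, hn⟩ :=
    (isCompact_range hf).exists_subset_of_directLimitSequence t hmono hunion hfinal hT1
  refine ⟨max k n, le_max_left _ _,
    fun y => hmono (le_max_right _ _) (hn (Set.mem_range_self y)), ?_⟩
  rw [hemb]
  exact hf.subtype_mk _

/-- Remark 3.9 (strict-system content, fundamental group): in a direct limit sequence of
T1 spaces whose inclusions `(X n, t n) → X` are topological embeddings, (i) every loop in
`X` based at `x ∈ X k` has image in some `X n` with `n ≥ k` and its corestriction is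
continuous for `t n`, and (ii) loops with values in `(X n, t n)` which are homotopic
relative to endpoints in `X` are homotopic relative to endpoints in some `(X m, t m)`
with `m ≥ n`. -/
theorem fundamentalGroup_of_directLimitSequence {X : Type*} [topX : TopologicalSpace X]
    (A : ℕ → Set X) (t : ∀ n, TopologicalSpace (A n))
    (hmono : Monotone A)
    (hunion : ⋃ n, A n = Set.univ)
    (hincl : ∀ m n (h : m ≤ n),
      @Continuous _ _ (t m) (t n) (Set.inclusion (hmono h)))
    (hfinal : ∀ U : Set X, IsOpen U ↔
      ∀ n, @IsOpen _ (t n) ((Subtype.val : A n → X) ⁻¹' U))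
    (hT1 : ∀ n, @T1Space _ (t n))
    (hemb : ∀ n, t n = TopologicalSpace.induced (Subtype.val : A n → X) topX)
    (k : ℕ) (x : X) (hx : x ∈ A k) :
    (∀ γ : Path x x, ∃ n, ∃ _ : k ≤ n, ∃ hsub : ∀ s : I, γ s ∈ A n,
        @Continuous _ _ _ (t n) (fun s : I => (⟨γ s, hsub s⟩ : A n))) ∧
    (∀ n (hkn : k ≤ n) (γ₁ γ₂ : I → A n),
      @Continuous _ _ _ (t n) γ₁ → @Continuous _ _ _ (t n) γ₂ →
      γ₁ 0 = ⟨x, hmono hkn hx⟩ → γ₁ 1 = ⟨x, hmono hkn hx⟩ →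
      γ₂ 0 = ⟨x, hmono hkn hx⟩ → γ₂ 1 = ⟨x, hmono hkn hx⟩ →
      (∃ H : I × I → X, Continuous H ∧
        (∀ s, H (0, s) = (γ₁ s : X)) ∧ (∀ s, H (1, s) = (γ₂ s : X)) ∧
        (∀ τ, H (τ, 0) = x) ∧ (∀ τ, H (τ, 1) = x)) →
      ∃ m, ∃ hnm : n ≤ m, ∃ H : I × I → A m,
        @Continuous _ _ _ (t m) H ∧
        (∀ s, H (0, s) = Set.inclusion (hmono hnm) (γ₁ s)) ∧
        (∀ s, H (1, s) = Set.inclusion (hmono hnm) (γ₂ s)) ∧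
        (∀ τ, H (τ, 0) = ⟨x, hmono (hkn.trans hnm) hx⟩) ∧
        (∀ τ, H (τ, 1) = ⟨x, hmono (hkn.trans hnm) hx⟩)) := by
  refine ⟨fun γ => ?_, ?_⟩
  · obtain ⟨n, hkn, h⟩ := γ.continuous.exists_corestrict_of_directLimitSequence
      t hmono hunion hfinal hT1 hemb k
    exact ⟨n, hkn, h⟩
  · rintro n hkn γ₁ γ₂ - - - - - - ⟨H, hH, h₁, h₂, h₃, h₄⟩
    obtain ⟨m, hnm, hsub, hcont⟩ := hH.exists_corestrict_of_directLimitSequence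
      t hmono hunion hfinal hT1 hemb n
    exact ⟨m, hnm, fun p => ⟨H p, hsub p⟩, hcont, fun s => Subtype.ext (h₁ s),
      fun s => Subtype.ext (h₂ s), fun τ => Subtype.ext (h₃ τ), fun τ => Subtype.ext (h₄ τ)⟩
end
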